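/- arXiv:1612.04507 — 2 statements merged into one kernel-verified Lean document; each statement's English description precedes it below -/
import Mathlib

section
/- Define, for a kernel K : ℝ → ℝ, the objective I(K) := ( ∫K(x)² dx )·( ∬K(x)K(y)·C₁(x,y) dx dy ). Then for every K satisfying: ∫K(x)dx = 1; K vanishes outside an open interval (A,B) with −∞ ≤ A < 0 < B ≤ +∞ and is Lipschitz and piecewise C¹ on (A,B); ∫|K(x)||x| dx < ∞; K(x)·x² → 0 as |x| → ∞; ∫|K′(x)|dx < ∞ and K′ has bounded total variation — one has I(K) ≥ 1/16. Moreover, the exponential kernel K^{opt}(x) := (1/2)·e^{−|x|} satisfies I(K^{opt}) = 1/16 (as does (b/2)e^{−b|x|} for every b > 0); hence the exponential kernel minimizes I, i.e., it minimizes the first-order approximation of the mean squared error of the kernel spot-volatility estimator for Brownian-motion-type volatilities (γ = 1). -/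
open MeasureTheory Set Filter Topology

/-- The kernel regularity conditions of the paper (Assumption 2.4, items (2)–(3)), for the
order `γ`: support an open interval `(A,B)` with `−∞ ≤ A < 0 < B ≤ +∞`, Lipschitz and
piecewise `C¹` on the support, `∫|K||x|^γ < ∞`, `K(x)x^{γ+1} → 0` as `|x| → ∞`,
`∫|K′| < ∞`, and `K′` of bounded total variation. -/
structure KernelReg (γ : ℝ) (K : ℝ → ℝ) where
  A : EReal
  B : EReal
  hA : A < 0
  hB : 0 < B
  supp : ∀ x : ℝ, ¬(A < (x : EReal) ∧ (x : EReal) < B) → K x = 0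
  lip : ∃ c : ℝ, 0 ≤ c ∧ ∀ x y : ℝ, A < (x : EReal) → (x : EReal) < B →
    A < (y : EReal) → (y : EReal) < B → |K x - K y| ≤ c * |x - y|
  piecewiseC1 : ∃ Pts : Finset ℝ, ∀ x : ℝ, A < (x : EReal) → (x : EReal) < B →
    x ∉ Pts → ContDiffAt ℝ 1 K x
  int_pow : Integrable fun x : ℝ => |K x| * |x| ^ γ
  decay : Tendsto (fun x : ℝ => K x * |x| ^ (γ + 1)) (cocompact ℝ) (𝓝 0)
  int_deriv : Integrable (deriv K)
  bv : BoundedVariationOn (deriv K) Set.univ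

/-- The covariance structure of Brownian-motion-driven volatilities:
`C₁(x,y) = min(|x|,|y|)·1_{xy ≥ 0}`. -/
noncomputable def C1 (x y : ℝ) : ℝ := if 0 ≤ x * y then min |x| |y| else 0

/-- The indicator of `t` lying strictly between `0` and `x`. -/
noncomputable def between (x t : ℝ) : ℝ := if (0 < t ∧ t < x) ∨ (x < t ∧ t < 0) then 1 else 0

/-- The mass of `K` lying beyond `t`, seen from the origin. -/
noncomputable def tailMass (K : ℝ → ℝ) (t : ℝ) : ℝ := ∫ x, K x * between x t

lemma measurable_between : Measurable fun p : ℝ × ℝ => between p.1 p.2 := by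
  unfold between
  refine Measurable.ite ?_ measurable_const measurable_const
  have h1 : MeasurableSet {p : ℝ × ℝ | 0 < p.2} := measurableSet_lt measurable_const measurable_snd
  have h2 : MeasurableSet {p : ℝ × ℝ | p.2 < p.1} := measurableSet_lt measurable_snd measurable_fst
  have h3 : MeasurableSet {p : ℝ × ℝ | p.1 < p.2} := measurableSet_lt measurable_fst measurable_snd
  have h4 : MeasurableSet {p : ℝ × ℝ | p.2 < 0} := measurableSet_lt measurable_snd measurable_const
  exact (h1.inter h2).union (h3.inter h4)

lemma between_nonneg (x t : ℝ) : 0 ≤ between x t := by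
  unfold between; split_ifs <;> norm_num

lemma norm_between_le_one (x t : ℝ) : ‖between x t‖ ≤ 1 := by
  unfold between; split_ifs <;> norm_num

lemma between_neg_neg (x t : ℝ) : between (-x) (-t) = between x t := by
  unfold between
  simp only [Left.neg_pos_iff, neg_lt_neg_iff, Left.neg_neg_iff]
  congr 1
  apply propext
  tauto

lemma C1_nonneg (x y : ℝ) : 0 ≤ C1 x y := by
  unfold C1; split_ifs <;> positivity

lemma C1_le_abs (x y : ℝ) : C1 x y ≤ |x| := by
  unfold C1; split_ifs
  · exact min_le_left _ _
  · positivity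

lemma measurable_C1 : Measurable fun p : ℝ × ℝ => C1 p.1 p.2 := by
  unfold C1
  refine Measurable.ite (measurableSet_le measurable_const (by fun_prop)) ?_ measurable_const
  exact (measurable_fst.abs).min measurable_snd.abs

lemma between_mul_between_eq_indicator (x y : ℝ) :
    (fun t => between x t * between y t) =
      (Ioo 0 (min x y) ∪ Ioo (max x y) 0).indicator fun _ => (1 : ℝ) := by
  funext t
  simp only [between, indicator, mem_union, mem_Ioo, lt_min_iff, max_lt_iff]
  grind

lemma integrable_between_mul_between (x y : ℝ) :
    Integrable fun t => between x t * between y t := by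
  rw [between_mul_between_eq_indicator,
    integrable_indicator_iff (measurableSet_Ioo.union measurableSet_Ioo)]
  exact (integrableOn_const (by simp)).union (integrableOn_const (by simp))

lemma integral_between_mul_between (x y : ℝ) :
    ∫ t, between x t * between y t = C1 x y := by
  rw [between_mul_between_eq_indicator,
    integral_indicator_const _ (measurableSet_Ioo.union measurableSet_Ioo), smul_eq_mul, mul_one]
  unfold C1
  rw [measureReal_union (by
    rw [Set.disjoint_left]; rintro t ⟨h1, -⟩ ⟨-, h2⟩; exact lt_asymm h1 h2) measurableSet_Ioo
    measure_Ioo_lt_top.ne measure_Ioo_lt_top.ne,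
    Real.volume_real_Ioo, Real.volume_real_Ioo]
  rcases le_total 0 x with hx | hx <;> rcases le_total 0 y with hy | hy
  · rw [if_pos (mul_nonneg hx hy), abs_of_nonneg hx, abs_of_nonneg hy]
    grind
  · split_ifs with h
    · have : x = 0 ∨ y = 0 := by
        rw [← mul_eq_zero]; exact le_antisymm (mul_nonpos_of_nonneg_of_nonpos hx hy) h
      grind
    · grind
  · split_ifs with h
    · have : x = 0 ∨ y = 0 := by
        rw [← mul_eq_zero]; exact le_antisymm (mul_nonpos_of_nonpos_of_nonneg hx hy) h
      grind
    · grind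
  · rw [if_pos (mul_nonneg_of_nonpos_of_nonpos hx hy), abs_of_nonpos hx, abs_of_nonpos hy]
    grind

section TailMass

variable {K : ℝ → ℝ}

lemma integrable_kernel_mul_between (hK : Integrable K) :
    Integrable fun p : ℝ × ℝ => K p.1 * K p.2 * between p.1 p.2 :=
  (hK.mul_prod hK).mul_bdd measurable_between.aestronglyMeasurable
    (Eventually.of_forall fun p => norm_between_le_one p.1 p.2)

lemma integrable_mul_tailMass (hK : Integrable K) :
    Integrable fun t => K t * tailMass K t := by
  refine (integrable_kernel_mul_between hK).integral_prod_right.congr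
    (Eventually.of_forall fun t => ?_)
  simp only [tailMass]
  rw [← integral_const_mul]
  congr 1 with x
  ring

lemma integrable_kernel_mul_C1 (hK : Integrable K) (hKx : Integrable fun x => K x * |x|) :
    Integrable fun p : ℝ × ℝ => K p.1 * K p.2 * C1 p.1 p.2 := by
  refine (hKx.mul_prod hK).mono ?_ (Eventually.of_forall fun p => ?_)
  · exact (hK.mul_prod hK).aestronglyMeasurable.mul measurable_C1.aestronglyMeasurable
  · simp only [norm_mul, Real.norm_eq_abs, abs_abs, abs_of_nonneg (C1_nonneg p.1 p.2)]
    calc |K p.1| * |K p.2| * C1 p.1 p.2 ≤ |K p.1| * |K p.2| * |p.1| := by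
          gcongr; exact C1_le_abs _ _
      _ = |K p.1| * |p.1| * |K p.2| := by ring

lemma integrable_kernel_mul_between_mul_between (hK : Integrable K)
    (hKx : Integrable fun x => K x * |x|) :
    Integrable (fun q : (ℝ × ℝ) × ℝ =>
      K q.1.1 * K q.1.2 * (between q.1.1 q.2 * between q.1.2 q.2)) := by
  rw [Measure.volume_eq_prod, integrable_prod_iff]
  · refine ⟨Eventually.of_forall fun p => (integrable_between_mul_between p.1 p.2).const_mul (K p.1 * K p.2), ?_⟩
    refine (integrable_kernel_mul_C1 hK hKx).norm.congr (Eventually.of_forall fun p => ?_)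
    have (t : ℝ) : ‖K p.1 * K p.2 * (between p.1 t * between p.2 t)‖ =
        ‖K p.1 * K p.2‖ * (between p.1 t * between p.2 t) := by
      rw [norm_mul, Real.norm_of_nonneg (mul_nonneg (between_nonneg _ _) (between_nonneg _ _))]
    simp only [this]
    rw [integral_const_mul, integral_between_mul_between, norm_mul,
      Real.norm_of_nonneg (C1_nonneg _ _)]
  · refine (hK.mul_prod hK).aestronglyMeasurable.comp_fst.mul
      (Measurable.aestronglyMeasurable ?_)
    exact (measurable_between.comp (measurable_fst.fst.prodMk measurable_snd)).mul
      (measurable_between.comp (measurable_fst.snd.prodMk measurable_snd))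

lemma integral_kernel_mul_between_mul_between (t : ℝ) :
    ∫ p : ℝ × ℝ, K p.1 * K p.2 * (between p.1 t * between p.2 t) = tailMass K t ^ 2 := by
  rw [sq, tailMass, ← integral_prod_mul, ← Measure.volume_eq_prod]
  congr 1 with p
  ring

lemma integrable_tailMass_sq (hK : Integrable K) (hKx : Integrable fun x => K x * |x|) :
    Integrable fun t => tailMass K t ^ 2 := by
  have := (integrable_kernel_mul_between_mul_between hK hKx).integral_prod_right
  simpa only [integral_kernel_mul_between_mul_between] using this

lemma integral_kernel_mul_C1 (hK : Integrable K) (hKx : Integrable fun x => K x * |x|) :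
    ∫ p : ℝ × ℝ, K p.1 * K p.2 * C1 p.1 p.2 = ∫ t, tailMass K t ^ 2 := by
  have h := integral_integral_swap (f := fun (p : ℝ × ℝ) t =>
    K p.1 * K p.2 * (between p.1 t * between p.2 t))
    (integrable_kernel_mul_between_mul_between hK hKx)
  simpa only [integral_kernel_mul_between_mul_between, integral_const_mul,
    integral_between_mul_between] using h

lemma between_add_between_comm {x t : ℝ} (ht : t ≠ 0) (hx : x ≠ 0) (hxt : x ≠ t) :
    between x t + between t x =
      (Ioi 0).indicator 1 x * (Ioi 0).indicator 1 t +
        (Iic 0).indicator 1 x * (Iic 0).indicator 1 t := by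
  simp only [between, indicator, mem_Ioi, mem_Iic, Pi.one_apply]
  grind

lemma two_mul_integral_mul_tailMass (hK : Integrable K) :
    2 * ∫ t, K t * tailMass K t = (∫ x in Ioi 0, K x) ^ 2 + (∫ x in Iic 0, K x) ^ 2 := by
  have hB := integrable_kernel_mul_between hK
  have hB' : Integrable fun p : ℝ × ℝ => K p.1 * K p.2 * between p.2 p.1 := by
    refine hB.swap.congr (Eventually.of_forall fun p => ?_)
    simp only [Function.comp, Prod.fst_swap, Prod.snd_swap]
    ring
  have e1 : ∫ t, K t * tailMass K t = ∫ p : ℝ × ℝ, K p.1 * K p.2 * between p.2 p.1 := by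
    rw [Measure.volume_eq_prod, integral_prod _ hB']
    congr 1 with t
    rw [tailMass, ← integral_const_mul]
    congr 1 with x
    ring
  have e2 : ∫ p : ℝ × ℝ, K p.1 * K p.2 * between p.1 p.2 =
      ∫ p : ℝ × ℝ, K p.1 * K p.2 * between p.2 p.1 := by
    rw [Measure.volume_eq_prod, ← integral_prod_swap]
    congr 1 with p
    simp only [Prod.fst_swap, Prod.snd_swap]
    ring
  have hP := hK.indicator (measurableSet_Ioi (a := (0 : ℝ)))
  have hN := hK.indicator (measurableSet_Iic (a := (0 : ℝ)))
  have hBB : Integrable fun p : ℝ × ℝ =>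
      K p.1 * K p.2 * between p.1 p.2 + K p.1 * K p.2 * between p.2 p.1 := hB.add hB'
  have hPP : Integrable fun p : ℝ × ℝ => (Ioi 0).indicator K p.1 * (Ioi 0).indicator K p.2 :=
    hP.mul_prod hP
  have hNN : Integrable fun p : ℝ × ℝ => (Iic 0).indicator K p.1 * (Iic 0).indicator K p.2 :=
    hN.mul_prod hN
  have hPN : Integrable fun p : ℝ × ℝ => (Ioi 0).indicator K p.1 * (Ioi 0).indicator K p.2 +
      (Iic 0).indicator K p.1 * (Iic 0).indicator K p.2 := hPP.add hNN
  have e3 : ∫ p : ℝ × ℝ, (K p.1 * K p.2 * between p.1 p.2 + K p.1 * K p.2 * between p.2 p.1) =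
      ∫ p : ℝ × ℝ, ((Ioi 0).indicator K p.1 * (Ioi 0).indicator K p.2 +
        (Iic 0).indicator K p.1 * (Iic 0).indicator K p.2) := by
    rw [Measure.volume_eq_prod, integral_prod _ hBB, integral_prod _ hPN]
    refine integral_congr_ae ?_
    filter_upwards [Measure.ae_ne volume 0] with x hx
    refine integral_congr_ae ?_
    filter_upwards [Measure.ae_ne volume 0, Measure.ae_ne volume x] with t ht hxt
    have h := between_add_between_comm ht hx hxt.symm
    simp only [← mul_add, h]
    simp only [indicator, Pi.one_apply]
    split_ifs <;> ring
  rw [integral_add hB hB', integral_add hPP hNN, e2, ← e1,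
    Measure.volume_eq_prod, integral_prod_mul, integral_prod_mul,
    integral_indicator measurableSet_Ioi, integral_indicator measurableSet_Iic] at e3
  linarith

lemma sq_integral_mul_le {f g : ℝ → ℝ} (hf : Integrable fun x => f x ^ 2)
    (hg : Integrable fun x => g x ^ 2) (hfg : Integrable fun x => f x * g x) :
    (∫ x, f x * g x) ^ 2 ≤ (∫ x, f x ^ 2) * ∫ x, g x ^ 2 := by
  have h := discrim_le_zero (a := ∫ x, g x ^ 2) (b := 2 * ∫ x, f x * g x) (c := ∫ x, f x ^ 2)
    fun s => by
      have e : ∫ x, (f x + s * g x) ^ 2 =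
          (∫ x, g x ^ 2) * (s * s) + (2 * ∫ x, f x * g x) * s + ∫ x, f x ^ 2 := by
        have : ∀ x, (f x + s * g x) ^ 2 = s * s * g x ^ 2 + 2 * s * (f x * g x) + f x ^ 2 :=
          fun x => by ring
        simp only [this]
        have hgfg : Integrable fun x => s * s * g x ^ 2 + 2 * s * (f x * g x) :=
          (hg.const_mul _).add (hfg.const_mul _)
        rw [integral_add hgfg hf, integral_add (hg.const_mul _) (hfg.const_mul _), integral_const_mul, integral_const_mul]
        ring
      rw [← e]
      exact integral_nonneg fun x => sq_nonneg _
  rw [discrim] at h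
  nlinarith

theorem one_div_sixteen_le_of_integrable (hK : Integrable K) (hK2 : Integrable fun x => K x ^ 2)
    (hKx : Integrable fun x => K x * |x|) (hK1 : ∫ x, K x = 1) :
    (1 / 16 : ℝ) ≤ (∫ x, K x ^ 2) * ∫ p : ℝ × ℝ, K p.1 * K p.2 * C1 p.1 p.2 := by
  rw [integral_kernel_mul_C1 hK hKx]
  have hcs := sq_integral_mul_le hK2 (integrable_tailMass_sq hK hKx) (integrable_mul_tailMass hK)
  have h2 := two_mul_integral_mul_tailMass hK
  have hsum := intervalIntegral.integral_Iic_add_Ioi (b := 0) hK.integrableOn hK.integrableOn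
  rw [hK1] at hsum
  have : 1 / 4 ≤ ∫ t, K t * tailMass K t := by
    nlinarith [sq_nonneg ((∫ x in Ioi 0, K x) - ∫ x in Iic 0, K x)]
  nlinarith

end TailMass

lemma KernelReg.exists_abs_le {K : ℝ → ℝ} (h : KernelReg 1 K) : ∃ M, ∀ x, |K x| ≤ M := by
  obtain ⟨c, hc, hlip⟩ := h.lip
  have hev : ∀ᶠ x in cocompact ℝ, |K x * |x| ^ (1 + 1 : ℝ)| < 1 := by
    have := h.decay.abs
    rw [abs_zero] at this
    exact this.eventually (gt_mem_nhds one_pos)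
  rw [← Metric.cobounded_eq_cocompact,
    (Metric.hasBasis_cobounded_compl_closedBall (0 : ℝ)).eventually_iff] at hev
  obtain ⟨R, -, hR⟩ := hev
  refine ⟨max 1 (|K 0| + c * max R 1), fun x => ?_⟩
  by_cases hx : max R 1 < |x|
  · refine le_max_of_le_left ?_
    have h1 := hR (x := x) (by simpa using (le_max_left R 1).trans_lt hx)
    have h2 : 1 ≤ |x| ^ (1 + 1 : ℝ) :=
      Real.one_le_rpow ((le_max_right R 1).trans hx.le) (by norm_num)
    rw [abs_mul, abs_of_nonneg (zero_le_one.trans h2)] at h1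
    nlinarith [abs_nonneg (K x)]
  · refine le_max_of_le_right ?_
    by_cases hs : h.A < (x : EReal) ∧ (x : EReal) < h.B
    · have h1 := hlip x 0 hs.1 hs.2 h.hA h.hB
      rw [sub_zero] at h1
      have h2 := abs_sub_abs_le_abs_sub (K x) (K 0)
      have h3 := mul_le_mul_of_nonneg_left (not_lt.1 hx) hc
      linarith
    · rw [h.supp x hs, abs_zero]
      positivity

lemma KernelReg.integrable_sq {K : ℝ → ℝ} (h : KernelReg 1 K) (hK : Integrable K) :
    Integrable fun x => K x ^ 2 := by
  obtain ⟨M, hM⟩ := h.exists_abs_le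
  simpa only [sq] using
    hK.mul_bdd hK.aestronglyMeasurable (Eventually.of_forall hM)

lemma KernelReg.integrable_mul_abs {K : ℝ → ℝ} (h : KernelReg 1 K) (hK : Integrable K) :
    Integrable fun x => K x * |x| := by
  refine h.int_pow.mono (hK.aestronglyMeasurable.mul (by fun_prop))
    (Eventually.of_forall fun x => ?_)
  simp

section Exponential

lemma integrable_comp_abs {f : ℝ → ℝ} (hf : IntegrableOn f (Ioi 0)) :
    Integrable fun x => f |x| := by
  rw [← integrableOn_univ, ← Iic_union_Ioi (a := (0 : ℝ))]
  refine IntegrableOn.union ?_ ?_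
  · rw [integrableOn_Iic_iff_integrableOn_Iio]
    refine (IntegrableOn.comp_neg_Iio (c := (0 : ℝ)) (by simpa using hf)).congr_fun
      (fun x hx => ?_) measurableSet_Iio
    rw [abs_of_neg hx]
  · refine hf.congr_fun (fun x hx => ?_) measurableSet_Ioi
    rw [abs_of_pos hx]

variable {b : ℝ}

lemma integrable_exp_neg_mul_abs (hb : 0 < b) : Integrable fun x => Real.exp (-b * |x|) :=
  integrable_comp_abs (integrableOn_exp_mul_Ioi (neg_neg_of_pos hb) 0)

lemma integrable_exp_neg_mul_abs_mul_abs (hb : 0 < b) :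
    Integrable fun x => Real.exp (-b * |x|) * |x| := by
  refine integrable_comp_abs (f := fun x => Real.exp (-b * x) * x) ?_
  refine (integrableOn_rpow_mul_exp_neg_mul_rpow (s := 1) (p := 1) (by norm_num) one_pos
    hb).congr_fun (fun x _ => ?_) measurableSet_Ioi
  simp only [Real.rpow_one]
  ring

lemma integral_exp_neg_mul_abs_sq (hb : 0 < b) :
    ∫ x, Real.exp (-b * |x|) ^ 2 = 1 / b := by
  rw [integral_comp_abs (f := fun x => Real.exp (-b * x) ^ 2)]
  have (x : ℝ) : Real.exp (-b * x) ^ 2 = Real.exp (-(2 * b) * x) := by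
    rw [← Real.exp_nat_mul]
    congr 1
    push_cast
    ring
  simp only [this]
  rw [integral_exp_mul_Ioi (by linarith)]
  simp
  field_simp

lemma tailMass_neg {K : ℝ → ℝ} (hK : ∀ x, K (-x) = K x) (t : ℝ) :
    tailMass K (-t) = tailMass K t := by
  rw [tailMass, ← integral_neg_eq_self]
  simp only [hK, between_neg_neg, tailMass]

lemma tailMass_exp_of_pos (hb : 0 < b) {t : ℝ} (ht : 0 < t) :
    tailMass (fun x => b / 2 * Real.exp (-b * |x|)) t = 1 / 2 * Real.exp (-b * t) := by
  have (x : ℝ) : b / 2 * Real.exp (-b * |x|) * between x t =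
      (Ioi t).indicator (fun x => b / 2 * Real.exp (-b * x)) x := by
    by_cases hx : t < x
    · rw [indicator_of_mem (mem_Ioi.2 hx), between, if_pos (Or.inl ⟨ht, hx⟩),
        abs_of_pos (ht.trans hx), mul_one]
    · rw [indicator_of_notMem (by simpa using hx), between, if_neg (by grind), mul_zero]
  simp only [tailMass, this]
  rw [integral_indicator measurableSet_Ioi, integral_const_mul,
    integral_exp_mul_Ioi (neg_neg_of_pos hb)]
  field_simp

lemma tailMass_exp (hb : 0 < b) {t : ℝ} (ht : t ≠ 0) :
    tailMass (fun x => b / 2 * Real.exp (-b * |x|)) t = 1 / 2 * Real.exp (-b * |t|) := by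
  rcases ht.lt_or_gt with h | h
  · rw [abs_of_neg h, ← tailMass_exp_of_pos hb (neg_pos.2 h), tailMass_neg]
    intro x
    rw [abs_neg]
  · rw [abs_of_pos h, tailMass_exp_of_pos hb h]

theorem objective_exp_eq (hb : 0 < b) :
    (∫ x : ℝ, ((b / 2) * Real.exp (-b * |x|)) ^ 2) *
      (∫ p : ℝ × ℝ, ((b / 2) * Real.exp (-b * |p.1|)) * ((b / 2) * Real.exp (-b * |p.2|)) *
        C1 p.1 p.2) = 1 / 16 := by
  have hKx : Integrable fun x => b / 2 * Real.exp (-b * |x|) * |x| := by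
    simpa only [mul_assoc] using (integrable_exp_neg_mul_abs_mul_abs hb).const_mul (b / 2)
  rw [integral_kernel_mul_C1 (K := fun x => b / 2 * Real.exp (-b * |x|))
    ((integrable_exp_neg_mul_abs hb).const_mul _) hKx]
  have e : ∫ t, tailMass (fun x => b / 2 * Real.exp (-b * |x|)) t ^ 2 =
      ∫ t, (1 / 2 * Real.exp (-b * |t|)) ^ 2 := by
    refine integral_congr_ae ?_
    filter_upwards [Measure.ae_ne volume 0] with t ht
    rw [tailMass_exp hb ht]
  simp only [e, mul_pow]
  rw [integral_const_mul, integral_const_mul, integral_exp_neg_mul_abs_sq hb]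
  field_simp
  norm_num

end Exponential

/-- The exponential kernel `K(x) = e^{−|x|}/2` minimizes the objective
`I(K) = (∫K²)·(∬ K K C₁)`: every admissible kernel with `∫K = 1` has `I(K) ≥ 1/16`, and the
exponential kernel (as well as each of its scalings `(b/2)e^{−b|x|}`) attains the value `1/16`
(Theorem 4.1 of the paper, optimal kernel for Brownian-motion-type volatility, `γ = 1`). -/
theorem stmt12 :
    (∀ K : ℝ → ℝ, KernelReg 1 K → (∫ x : ℝ, K x) = 1 →
      (1 / 16 : ℝ) ≤ (∫ x : ℝ, (K x) ^ 2) * ∫ p : ℝ × ℝ, K p.1 * K p.2 * C1 p.1 p.2) ∧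
    ((∫ x : ℝ, ((1 / 2) * Real.exp (-|x|)) ^ 2) *
        (∫ p : ℝ × ℝ, ((1 / 2) * Real.exp (-|p.1|)) * ((1 / 2) * Real.exp (-|p.2|)) *
          C1 p.1 p.2) = 1 / 16) ∧
    (∀ b : ℝ, 0 < b →
      (∫ x : ℝ, ((b / 2) * Real.exp (-b * |x|)) ^ 2) *
        (∫ p : ℝ × ℝ, ((b / 2) * Real.exp (-b * |p.1|)) * ((b / 2) * Real.exp (-b * |p.2|)) *
          C1 p.1 p.2) = 1 / 16) := by
  refine ⟨fun K h hK1 => ?_, ?_, fun b hb => objective_exp_eq hb⟩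
  · have hK : Integrable K := by
      by_contra hK
      rw [integral_undef hK] at hK1
      exact zero_ne_one hK1
    exact one_div_sixteen_le_of_integrable hK (h.integrable_sq hK) (h.integrable_mul_abs hK) hK1
  · simpa only [neg_mul, one_mul] using objective_exp_eq one_pos
end

section
/- For every γ ∈ (0,2], the function C_γ(r,s) := (1/2)(|r|^γ + |s|^γ − |r−s|^γ) is non-negative definite on ℝ: for every n ∈ ℕ, all x₁, …, x_n ∈ ℝ and all c₁, …, c_n ∈ ℝ, ∑_{i=1}^n ∑_{j=1}^n c_i c_j C_γ(x_i, x_j) ≥ 0. -/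
open MeasureTheory Set in
/-- Integrability of the Lévy–Khinchine integrand of `|r| ^ γ`. -/
theorem integrableOn_one_sub_cos_mul_rpow {γ : ℝ} (hγ0 : 0 < γ) (hγ2 : γ < 2) (r : ℝ) :
    IntegrableOn (fun t : ℝ => (1 - Real.cos (t * r)) * t ^ (-1 - γ)) (Ioi 0) := by
  have hmeas : Measurable fun t : ℝ => (1 - Real.cos (t * r)) * t ^ (-1 - γ) := by fun_prop
  have hnonneg : ∀ t : ℝ, 0 ≤ 1 - Real.cos (t * r) := fun t => by
    linarith [Real.cos_le_one (t * r)]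
  rw [← Ioc_union_Ioi_eq_Ioi (zero_le_one : (0 : ℝ) ≤ 1)]
  refine IntegrableOn.union ?_ ?_
  · have h : IntegrableOn (fun t : ℝ => r ^ 2 / 2 * t ^ (1 - γ)) (Ioc 0 1) := by
      have h1 := intervalIntegral.intervalIntegrable_rpow' (a := 0) (b := 1)
        (r := 1 - γ) (by linarith)
      exact ((intervalIntegrable_iff_integrableOn_Ioc_of_le zero_le_one).1 h1).const_mul _
    refine h.mono' hmeas.aestronglyMeasurable ?_
    filter_upwards [ae_restrict_mem measurableSet_Ioc] with t ht
    have ht0 : 0 < t := ht.1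
    have hpow : t ^ (1 - γ) = t ^ 2 * t ^ (-1 - γ) := by
      rw [← Real.rpow_natCast t 2, ← Real.rpow_add ht0]
      congr 1
      push_cast
      ring
    have hp : 0 ≤ t ^ (-1 - γ) := Real.rpow_nonneg ht0.le _
    rw [Real.norm_of_nonneg (mul_nonneg (hnonneg t) hp), hpow, ← mul_assoc]
    refine mul_le_mul_of_nonneg_right ?_ hp
    linarith [Real.one_sub_sq_div_two_le_cos (x := t * r), mul_pow t r 2]
  · have h : IntegrableOn (fun t : ℝ => 2 * t ^ (-1 - γ)) (Ioi 1) :=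
      (integrableOn_Ioi_rpow_of_lt (by linarith) zero_lt_one).const_mul _
    refine h.mono' hmeas.aestronglyMeasurable ?_
    filter_upwards [ae_restrict_mem measurableSet_Ioi] with t ht
    have hp : 0 ≤ t ^ (-1 - γ) := Real.rpow_nonneg (zero_le_one.trans (le_of_lt ht)) _
    rw [Real.norm_of_nonneg (mul_nonneg (hnonneg t) hp)]
    exact mul_le_mul_of_nonneg_right (by linarith [Real.neg_one_le_cos (t * r)]) hp

open MeasureTheory Set in
/-- The scaling identity behind the Lévy–Khinchine representation of `|r| ^ γ`. -/
theorem integral_one_sub_cos_mul_rpow {γ : ℝ} (hγ0 : 0 < γ) (r : ℝ) :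
    ∫ t in Ioi (0 : ℝ), (1 - Real.cos (t * r)) * t ^ (-1 - γ) =
      |r| ^ γ * ∫ t in Ioi (0 : ℝ), (1 - Real.cos t) * t ^ (-1 - γ) := by
  rcases eq_or_ne r 0 with rfl | hr
  · simp [Real.zero_rpow hγ0.ne']
  have hr' : 0 < |r| := abs_pos.2 hr
  have hscale := integral_comp_mul_left_Ioi
    (fun t : ℝ => (1 - Real.cos t) * t ^ (-1 - γ)) 0 hr'
  rw [mul_zero, smul_eq_mul] at hscale
  have hpt : ∀ t ∈ Ioi (0 : ℝ), (1 - Real.cos (t * r)) * t ^ (-1 - γ) =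
      |r| ^ (1 + γ) * ((1 - Real.cos (|r| * t)) * (|r| * t) ^ (-1 - γ)) := fun t ht => by
    have ht0 : 0 < t := ht
    have hcos : Real.cos (|r| * t) = Real.cos (t * r) := by
      rw [← Real.cos_abs (t * r), abs_mul, abs_of_pos ht0, mul_comm]
    have hone : |r| ^ (1 + γ) * |r| ^ (-1 - γ) = 1 := by
      rw [← Real.rpow_add hr']
      ring_nf
      exact Real.rpow_zero _
    rw [hcos, Real.mul_rpow hr'.le ht0.le]
    linear_combination (-(1 - Real.cos (t * r)) * t ^ (-1 - γ)) * hone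
  rw [setIntegral_congr_fun measurableSet_Ioi hpt, integral_const_mul, hscale, ← mul_assoc,
    Real.rpow_add hr', Real.rpow_one]
  field_simp

open MeasureTheory Set in
theorem integral_one_sub_cos_mul_rpow_pos {γ : ℝ} (hγ0 : 0 < γ) (hγ2 : γ < 2) :
    0 < ∫ t in Ioi (0 : ℝ), (1 - Real.cos t) * t ^ (-1 - γ) := by
  have hint : IntegrableOn (fun t : ℝ => (1 - Real.cos t) * t ^ (-1 - γ)) (Ioi 0) := by
    simpa using integrableOn_one_sub_cos_mul_rpow hγ0 hγ2 1
  rw [setIntegral_pos_iff_support_of_nonneg_ae _ hint]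
  · refine lt_of_lt_of_le (b := volume (Ioo (0 : ℝ) 1)) (by simp) (measure_mono fun t ht => ?_)
    refine ⟨(mul_pos ?_ (Real.rpow_pos_of_pos ht.1 _)).ne', ht.1⟩
    have := Real.cos_lt_cos_of_nonneg_of_le_pi le_rfl
      (by linarith [ht.2, Real.pi_gt_three]) ht.1
    rw [Real.cos_zero] at this
    linarith
  · filter_upwards [ae_restrict_mem measurableSet_Ioi] with t ht
    exact mul_nonneg (by linarith [Real.cos_le_one t]) (Real.rpow_nonneg (le_of_lt ht) _)

theorem sum_sum_mul_mul_eq_sq {ι : Type*} [Fintype ι] (c f : ι → ℝ) :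
    ∑ i, ∑ j, c i * c j * (f i * f j) = (∑ i, c i * f i) ^ 2 := by
  rw [sq, Finset.sum_mul_sum]
  exact Finset.sum_congr rfl fun i _ => Finset.sum_congr rfl fun j _ => by ring

theorem sum_sum_one_sub_cos_nonneg {ι : Type*} [Fintype ι] (x c : ι → ℝ) (t : ℝ) :
    0 ≤ ∑ i, ∑ j, c i * c j * ((1 - Real.cos (t * x i)) + (1 - Real.cos (t * x j)) -
      (1 - Real.cos (t * (x i - x j)))) := by
  have h : ∀ i j, c i * c j * ((1 - Real.cos (t * x i)) + (1 - Real.cos (t * x j)) -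
      (1 - Real.cos (t * (x i - x j)))) =
      c i * c j * ((1 - Real.cos (t * x i)) * (1 - Real.cos (t * x j))) +
      c i * c j * (Real.sin (t * x i) * Real.sin (t * x j)) := fun i j => by
    rw [mul_sub t, Real.cos_sub]
    ring
  simp only [h, Finset.sum_add_distrib]
  rw [sum_sum_mul_mul_eq_sq c fun i => 1 - Real.cos (t * x i),
    sum_sum_mul_mul_eq_sq c fun i => Real.sin (t * x i)]
  positivity

open MeasureTheory Set in
/-- For every `γ ∈ (0,2]`, the function `C_γ(r,s) = (|r|^γ + |s|^γ − |r−s|^γ)/2`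
(the fBM covariance structure) is non-negative definite on `ℝ`. -/
theorem stmt14 (γ : ℝ) (hγ0 : 0 < γ) (hγ2 : γ ≤ 2) (n : ℕ) (x c : Fin n → ℝ) :
    0 ≤ ∑ i, ∑ j, c i * c j * ((|x i| ^ γ + |x j| ^ γ - |x i - x j| ^ γ) / 2) := by
  rcases hγ2.eq_or_lt with rfl | hγ2
  · have h : ∀ i j, c i * c j * ((|x i| ^ (2 : ℝ) + |x j| ^ (2 : ℝ) -
        |x i - x j| ^ (2 : ℝ)) / 2) = c i * c j * (x i * x j) := fun i j => by
      simp only [Real.rpow_two, sq_abs]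
      ring
    simp only [h, sum_sum_mul_mul_eq_sq]
    positivity
  set K := ∫ t in Ioi (0 : ℝ), (1 - Real.cos t) * t ^ (-1 - γ)
  have hKpos : 0 < K := integral_one_sub_cos_mul_rpow_pos hγ0 hγ2
  let g : ℝ → ℝ → ℝ := fun r t => (1 - Real.cos (t * r)) * t ^ (-1 - γ)
  have hg : ∀ r, IntegrableOn (g r) (Ioi 0) := integrableOn_one_sub_cos_mul_rpow hγ0 hγ2
  have hgK : ∀ r, ∫ t in Ioi (0 : ℝ), g r t = |r| ^ γ * K := integral_one_sub_cos_mul_rpow hγ0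
  have hgint : ∀ i j, IntegrableOn
      (fun t => c i * c j * (g (x i) t + g (x j) t - g (x i - x j) t)) (Ioi 0) :=
    fun i j => (((hg _).add (hg _)).sub (hg _)).const_mul _
  have hterm : ∀ i j, ∫ t in Ioi (0 : ℝ), c i * c j * (g (x i) t + g (x j) t - g (x i - x j) t) =
      2 * K * (c i * c j * ((|x i| ^ γ + |x j| ^ γ - |x i - x j| ^ γ) / 2)) := fun i j => by
    have hadd : IntegrableOn (fun t => g (x i) t + g (x j) t) (Ioi 0) := (hg _).add (hg _)
    rw [integral_const_mul, integral_sub hadd (hg _), integral_add (hg _) (hg _), hgK, hgK, hgK]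
    ring
  refine (mul_nonneg_iff_of_pos_left (show 0 < 2 * K by positivity)).1 ?_
  simp only [Finset.mul_sum, ← hterm]
  simp_rw [← integral_finsetSum Finset.univ fun j _ => hgint _ j]
  rw [← integral_finsetSum Finset.univ fun i _ =>
    integrable_finsetSum Finset.univ fun j _ => hgint i j]
  refine setIntegral_nonneg measurableSet_Ioi fun t ht => ?_
  have hp : 0 ≤ t ^ (-1 - γ) := Real.rpow_nonneg (le_of_lt ht) _
  refine (mul_nonneg (sum_sum_one_sub_cos_nonneg x c t) hp).trans_eq ?_
  simp only [Finset.sum_mul]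
  exact Finset.sum_congr rfl fun i _ => Finset.sum_congr rfl fun j _ => by
    simp only [g]
    ring
end
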